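/- Let p > 1. Assume that all functions in N^{1,p}(X) are quasicontinuous and that X has the zero p-weak upper gradient property. Then for every A ⊂ E, either ~cap_p(A,E) = cap_p(A,E) or ~cap_p(A,E) = ∞. -/

import Mathlib

open MeasureTheory Metric Set Filter
open scoped ENNReal NNReal Topology

noncomputable section

variable {X : Type*} [MetricSpace X] [MeasurableSpace X] [BorelSpace X]

/-- A nonconstant, compact, rectifiable curve in `X`, parameterized by arc length on
`[0, len]`. The arc-length parameterization is expressed by requiring that the length
(total variation) of the curve on each subinterval `[s, t]` equals `t - s`. -/
structure Curve (X : Type*) [MetricSpace X] where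
  len : ℝ
  len_pos : 0 < len
  toFun : ℝ → X
  continuousOn : ContinuousOn toFun (Set.Icc 0 len)
  arclength : ∀ s t : ℝ, s ∈ Set.Icc 0 len → t ∈ Set.Icc 0 len → s ≤ t →
    eVariationOn toFun (Set.Icc s t) = ENNReal.ofReal (t - s)
  nonconstant : ∃ s ∈ Set.Icc 0 len, ∃ t ∈ Set.Icc 0 len, toFun s ≠ toFun t

/-- The curve integral `∫_γ g ds` of a nonnegative function along an arc-length
parameterized curve. -/
def Curve.integral (γ : Curve X) (g : X → ℝ≥0∞) : ℝ≥0∞ :=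
  ∫⁻ t in Set.Icc (0 : ℝ) γ.len, g (γ.toFun t)

/-- `|a - b|` with the convention that it is `∞` whenever both `a` and `b` are infinite. -/
def ugDiff (a b : EReal) : ℝ≥0∞ :=
  if a.abs = ⊤ ∨ b.abs = ⊤ then ⊤ else (a - b).abs

/-- The upper gradient inequality for `f` and `g` along the curve `γ`. -/
def UGOn (f : X → EReal) (g : X → ℝ≥0∞) (γ : Curve X) : Prop :=
  ugDiff (f (γ.toFun 0)) (f (γ.toFun γ.len)) ≤ γ.integral g

/-- A curve family has zero `p`-modulus. -/
def ZeroModulus (p : ℝ) (μ : Measure X) (Γ : Set (Curve X)) : Prop :=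
  ∃ ρ : X → ℝ≥0∞, Measurable ρ ∧ (∫⁻ x, ρ x ^ p ∂μ) < ⊤ ∧ ∀ γ ∈ Γ, γ.integral ρ = ⊤

/-- `g` is an upper gradient of `f`. -/
def IsUpperGradient (f : X → EReal) (g : X → ℝ≥0∞) : Prop :=
  Measurable g ∧ ∀ γ : Curve X, UGOn f g γ

/-- `g` is a `p`-weak upper gradient of `f`: the upper gradient inequality holds for
`p`-almost every curve. -/
def IsWeakUpperGradient (p : ℝ) (μ : Measure X) (f : X → EReal) (g : X → ℝ≥0∞) : Prop :=
  Measurable g ∧ ZeroModulus p μ {γ : Curve X | ¬ UGOn f g γ}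

/-- The energy `∫_X g_u^p dμ` of the minimal `p`-weak upper gradient of `u`, expressed as
the infimum of `∫_X g^p dμ` over all `p`-weak upper gradients `g` of `u`
(`= ∞` if `u` has no `p`-weak upper gradient). -/
def gradEnergy (p : ℝ) (μ : Measure X) (u : X → EReal) : ℝ≥0∞ :=
  ⨅ (g : X → ℝ≥0∞) (_ : IsWeakUpperGradient p μ u g), ∫⁻ x, g x ^ p ∂μ

/-- The Newtonian energy `‖u‖_{N^{1,p}(X)}^p = ∫_X |u|^p dμ + ∫_X g_u^p dμ`. -/
def newtonianEnergy (p : ℝ) (μ : Measure X) (u : X → EReal) : ℝ≥0∞ :=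
  (∫⁻ x, (u x).abs ^ p ∂μ) + gradEnergy p μ u

/-- Membership in the Newtonian space `N^{1,p}(X)` (measurability is with respect to the
completion of the Borel σ-algebra, i.e. a.e.-measurability). -/
def MemNewtonian (p : ℝ) (μ : Measure X) (u : X → EReal) : Prop :=
  AEMeasurable u μ ∧ newtonianEnergy p μ u < ⊤

/-- Membership in `N^{1,p}_0(E)`, members being regarded as functions on all of `X`
that vanish outside `E`. -/
def MemNewtonian0 (p : ℝ) (μ : Measure X) (E : Set X) (u : X → EReal) : Prop :=
  MemNewtonian p μ u ∧ ∀ x ∉ E, u x = 0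

/-- The Sobolev capacity `C_p(A)`. -/
def sobolevCapacity (p : ℝ) (μ : Measure X) (A : Set X) : ℝ≥0∞ :=
  ⨅ (u : X → EReal) (_ : MemNewtonian p μ u ∧ ∀ x ∈ A, u x = 1), newtonianEnergy p μ u

/-- The variational capacity `cap_p(A, E)`. -/
def varCapacity (p : ℝ) (μ : Measure X) (A E : Set X) : ℝ≥0∞ :=
  ⨅ (u : X → EReal) (_ : MemNewtonian0 p μ E u ∧ ∀ x ∈ A, 1 ≤ u x), gradEnergy p μ u

/-- A function is quasicontinuous if outside open sets of arbitrarily small Sobolev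
capacity it is real-valued and continuous. -/
def QuasicontinuousFun (p : ℝ) (μ : Measure X) (u : X → EReal) : Prop :=
  ∀ ε : ℝ≥0∞, 0 < ε → ∃ G : Set X, IsOpen G ∧ sobolevCapacity p μ G < ε ∧
    (∀ x ∈ Gᶜ, u x ≠ ⊤ ∧ u x ≠ ⊥) ∧ ContinuousOn u Gᶜ

/-- The capacity `~cap_p(A,E)`: the infimum of `cap_p(G,E)` over all relatively open
subsets `G` of `E` containing `A`. -/
def varCapacityT (p : ℝ) (μ : Measure X) (A E : Set X) : ℝ≥0∞ :=
  ⨅ (G : Set X) (_ : A ⊆ G ∧ G ⊆ E ∧ ∃ U : Set X, IsOpen U ∧ G = U ∩ E),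
    varCapacity p μ G E


/-- `g` is a `p`-weak upper gradient of `f` in the set `S` (i.e. with respect to the
metric measure space `S`): the upper gradient inequality holds for `p`-almost every
curve lying in `S`. -/
def IsWeakUpperGradientOn (p : ℝ) (μ : Measure X) (S : Set X) (f : X → EReal)
    (g : X → ℝ≥0∞) : Prop :=
  Measurable g ∧ ZeroModulus p (μ.restrict S)
    {γ : Curve X | (∀ t ∈ Set.Icc 0 γ.len, γ.toFun t ∈ S) ∧ ¬ UGOn f g γ}

/-- `X` has the zero `p`-weak upper gradient property: every measurable function having
`0` as a `p`-weak upper gradient in some ball `B(x,r)` is essentially constant in some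
smaller ball `B(x,δ)`. -/
def ZeroWUGProperty (p : ℝ) (μ : Measure X) : Prop :=
  ∀ (f : X → EReal), AEMeasurable f μ → ∀ (x : X) (r : ℝ), 0 < r →
    IsWeakUpperGradientOn p μ (Metric.ball x r) f (fun _ => 0) →
    ∃ δ : ℝ, 0 < δ ∧ δ ≤ r ∧ ∃ c : EReal,
      ∀ᵐ y ∂(μ.restrict (Metric.ball x δ)), f y = c

set_option linter.unusedSectionVars false

/-- A function whose local increments are controlled by the integral of `m` has its total
increment controlled by the integral of `m`. -/
theorem edist_le_setLIntegral_of_local {P : ℝ → ℝ} {m : ℝ → ℝ≥0∞} {L τ : ℝ} (hL : 0 < L)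
    (hτ : 0 < τ)
    (h : ∀ s t, 0 ≤ s → s ≤ t → t ≤ L → t - s < τ →
      edist (P s) (P t) ≤ ∫⁻ r in Icc s t, m r) :
    edist (P 0) (P L) ≤ ∫⁻ r in Icc 0 L, m r := by
  obtain ⟨n, hn⟩ := exists_nat_gt (L / τ)
  have hn0 : (0 : ℝ) < n := lt_trans (by positivity) hn
  have hstep : L / n < τ := by
    rw [div_lt_iff₀ hτ] at hn
    rw [div_lt_iff₀ hn0]
    linarith
  have hpos : 0 < L / n := by positivity
  have key : ∀ i : ℕ, i ≤ n →
      edist (P 0) (P (i * (L / n))) ≤ ∫⁻ r in Ioc 0 (i * (L / n)), m r := by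
    intro i
    induction i with
    | zero => intro _; simp
    | succ k ih =>
      intro hk
      have h1 := ih (by omega)
      have hkn : ((k + 1 : ℕ) : ℝ) ≤ n := by exact_mod_cast hk
      have hk0 : (0 : ℝ) ≤ k * (L / n) := by positivity
      have hle : (k : ℝ) * (L / n) ≤ ((k + 1 : ℕ) : ℝ) * (L / n) := by
        push_cast; nlinarith
      have h2 := h (k * (L / n)) (((k + 1 : ℕ) : ℝ) * (L / n)) hk0 hle
        (by
          calc ((k + 1 : ℕ) : ℝ) * (L / n) ≤ n * (L / n) := by gcongr
            _ = L := by field_simp)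
        (by push_cast; linarith)
      rw [← Measure.restrict_congr_set (Ioc_ae_eq_Icc (μ := volume))] at h2
      rw [← Ioc_union_Ioc_eq_Ioc hk0 hle, lintegral_union measurableSet_Ioc
        (Set.Ioc_disjoint_Ioc_of_le le_rfl)]
      exact (edist_triangle _ _ _).trans (add_le_add h1 h2)
  have h3 := key n le_rfl
  rw [show (n : ℝ) * (L / n) = L by field_simp] at h3
  exact h3.trans (lintegral_mono_set Ioc_subset_Icc_self)

/-- A function whose increments are controlled by the integral of an integrable function is
uniformly continuous. -/
theorem exists_forall_edist_lt_of_le_setLIntegral {F : ℝ → ℝ} {k : ℝ → ℝ≥0∞} {L : ℝ}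
    (hk : ∫⁻ r in Icc 0 L, k r ≠ ⊤)
    (h : ∀ s t, 0 ≤ s → s ≤ t → t ≤ L → edist (F s) (F t) ≤ ∫⁻ r in Icc s t, k r)
    {δ : ℝ} (hδ : 0 < δ) :
    ∃ τ > 0, ∀ s t, 0 ≤ s → s ≤ t → t ≤ L → t - s < τ → |F s - F t| < δ := by
  obtain ⟨η, hη, hη'⟩ := exists_pos_setLIntegral_lt_of_measure_lt hk
    (ε := ENNReal.ofReal δ) (by simpa using hδ)
  obtain ⟨τ, hτ0, hτ⟩ : ∃ τ : ℝ, 0 < τ ∧ ENNReal.ofReal τ ≤ η := by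
    rcases eq_or_ne η ⊤ with rfl | hη1
    · exact ⟨1, one_pos, le_top⟩
    · exact ⟨η.toReal, ENNReal.toReal_pos hη.ne' hη1, by rw [ENNReal.ofReal_toReal hη1]⟩
  refine ⟨τ, hτ0, fun s t hs hst ht hlt => ?_⟩
  have hsub : Icc s t ⊆ Icc 0 L := Icc_subset_Icc hs ht
  have h1 := hη' (Icc s t) (by
    rw [Measure.restrict_apply measurableSet_Icc, inter_eq_left.mpr hsub, Real.volume_Icc]
    exact (ENNReal.ofReal_lt_ofReal_iff hτ0).mpr hlt |>.trans_le hτ)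
  rw [Measure.restrict_restrict measurableSet_Icc, inter_eq_left.mpr hsub] at h1
  have h2 := (h s t hs hst ht).trans_lt h1
  rw [edist_dist, Real.dist_eq] at h2
  exact (ENNReal.ofReal_lt_ofReal_iff hδ).mp h2

/-- Leibniz rule along an interval, in integrated form. -/
theorem edist_mul_le_setLIntegral {W H : ℝ → ℝ} {k m : ℝ → ℝ≥0∞} {L : ℝ} (hL : 0 < L)
    (hW0 : ∀ r, 0 ≤ W r) (hH0 : ∀ r, 0 ≤ H r) (hH1 : ∀ r, H r ≤ 1)
    (hk : ∫⁻ r in Icc 0 L, k r ≠ ⊤) (hm : ∫⁻ r in Icc 0 L, m r ≠ ⊤)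
    (hmm : AEMeasurable m (volume.restrict (Icc 0 L)))
    (hW : ∀ s t, 0 ≤ s → s ≤ t → t ≤ L → edist (W s) (W t) ≤ ∫⁻ r in Icc s t, k r)
    (hH : ∀ s t, 0 ≤ s → s ≤ t → t ≤ L → edist (H s) (H t) ≤ ∫⁻ r in Icc s t, m r) :
    edist (W 0 * H 0) (W L * H L) ≤
      ∫⁻ r in Icc 0 L, (k r + ENNReal.ofReal (W r) * m r) := by
  refine ENNReal.le_of_forall_pos_le_add fun ε hε _ => ?_
  obtain ⟨δ, hδ, hδε⟩ := ENNReal.exists_nnreal_pos_mul_lt hm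
    (b := (ε : ℝ≥0∞)) (by simpa using hε.ne')
  obtain ⟨τ, hτ, hτδ⟩ := exists_forall_edist_lt_of_le_setLIntegral hk hW
    (δ := (δ : ℝ)) (by exact_mod_cast hδ)
  have key : edist (W 0 * H 0) (W L * H L) ≤
      ∫⁻ r in Icc 0 L, (k r + (ENNReal.ofReal (W r) + δ) * m r) := by
    refine edist_le_setLIntegral_of_local (P := fun r => W r * H r) hL hτ
      fun s t hs hst ht hlt => ?_
    have e1 : edist (W s * H s) (W t * H t) ≤
        edist (W s) (W t) + ENNReal.ofReal (W s) * edist (H s) (H t) := by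
      simp only [edist_dist, Real.dist_eq]
      rw [← ENNReal.ofReal_mul (hW0 s), ← ENNReal.ofReal_add (abs_nonneg _)
        (mul_nonneg (hW0 s) (abs_nonneg _))]
      refine ENNReal.ofReal_le_ofReal ?_
      calc |W s * H s - W t * H t|
          = |(W s - W t) * H t + W s * (H s - H t)| := by ring_nf
        _ ≤ |W s - W t| * H t + W s * |H s - H t| := by
            refine (abs_add_le _ _).trans ?_
            rw [abs_mul, abs_mul, abs_of_nonneg (hH0 t), abs_of_nonneg (hW0 s)]
        _ ≤ _ := by
            gcongr
            exact mul_le_of_le_one_right (abs_nonneg _) (hH1 t)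
    have e2 : ENNReal.ofReal (W s) * edist (H s) (H t) ≤
        ∫⁻ r in Icc s t, (ENNReal.ofReal (W r) + δ) * m r := by
      calc _ ≤ ENNReal.ofReal (W s) * ∫⁻ r in Icc s t, m r := by
            gcongr; exact hH s t hs hst ht
        _ ≤ ∫⁻ r in Icc s t, ENNReal.ofReal (W s) * m r := lintegral_const_mul_le _ _
        _ ≤ _ := by
            refine setLIntegral_mono' measurableSet_Icc fun r hr => ?_
            gcongr
            have := hτδ s r hs hr.1 (hr.2.trans ht) (by linarith [hr.2])
            calc ENNReal.ofReal (W s) ≤ ENNReal.ofReal (W r + δ) :=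
                  ENNReal.ofReal_le_ofReal (by linarith [le_abs_self (W s - W r)])
              _ ≤ _ := by
                  refine ENNReal.ofReal_add_le.trans ?_
                  simp
    exact (e1.trans (add_le_add (hW s t hs hst ht) e2)).trans (le_lintegral_add _ _)
  calc _ ≤ _ := key
    _ = ∫⁻ r in Icc 0 L, ((k r + ENNReal.ofReal (W r) * m r) + δ * m r) := by
        congr 1; ext r; ring
    _ = _ := lintegral_add_right' _ (hmm.const_mul _)
    _ ≤ _ := by
        gcongr
        rw [lintegral_const_mul' _ _ ENNReal.coe_ne_top]
        exact hδε.le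

/-- Multiplying an `L^p` function by factors in `[0,1]` that are small in `L^p` gives
functions that are small in `L^p`. -/
theorem exists_forall_lintegral_mul_rpow_le {α : Type*} [MeasurableSpace α] {ν : Measure α}
    {p : ℝ} (hp : 0 < p) {g : α → ℝ≥0∞} (hgm : Measurable g)
    (hg : ∫⁻ x, g x ^ p ∂ν ≠ ⊤)
    {ε : ℝ≥0∞} (hε : ε ≠ 0) :
    ∃ δ > 0, ∀ w : α → ℝ≥0∞, Measurable w → (∀ x, w x ≤ 1) → ∫⁻ x, w x ^ p ∂ν < δ →
      ∫⁻ x, (w x * g x) ^ p ∂ν ≤ ε := by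
  have hε2 : ε / 2 ≠ 0 := by simpa using hε
  obtain ⟨δ, hδ, h1⟩ := exists_pos_setLIntegral_lt_of_measure_lt hg hε2
  obtain ⟨q, hq, h2⟩ := ENNReal.exists_nnreal_pos_mul_lt hg hε2
  have hq0 : (q : ℝ≥0∞) ≠ 0 := by simpa using hq.ne'
  refine ⟨q * δ, by positivity, fun w hw hw1 hlt => ?_⟩
  have hwp : Measurable fun x => w x ^ p := hw.pow_const p
  set S := {x | (q : ℝ≥0∞) ≤ w x ^ p} with hS
  have hSm : MeasurableSet S := measurableSet_le measurable_const hwp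
  have hμS : ν S < δ := by
    have := (mul_meas_ge_le_lintegral hwp (q : ℝ≥0∞) (μ := ν)).trans_lt hlt
    exact (ENNReal.mul_lt_mul_iff_right hq0 ENNReal.coe_ne_top).mp this
  calc ∫⁻ x, (w x * g x) ^ p ∂ν
      ≤ ∫⁻ x, (S.indicator (fun x => g x ^ p) x + q * g x ^ p) ∂ν := by
        refine lintegral_mono fun x => ?_
        rw [ENNReal.mul_rpow_of_nonneg _ _ hp.le]
        by_cases hx : x ∈ S
        · rw [indicator_of_mem hx]
          refine le_add_right (mul_le_of_le_one_left zero_le ?_)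
          exact ENNReal.rpow_le_one (hw1 x) hp.le
        · rw [indicator_of_notMem hx, zero_add]
          gcongr
          exact (not_le.mp hx).le
    _ = ∫⁻ x in S, g x ^ p ∂ν + q * ∫⁻ x, g x ^ p ∂ν := by
        rw [lintegral_add_left ((hgm.pow_const p).indicator hSm), lintegral_indicator hSm,
          lintegral_const_mul' _ _ ENNReal.coe_ne_top]
    _ ≤ ε / 2 + ε / 2 := add_le_add (h1 S hμS).le h2.le
    _ = ε := ENNReal.add_halves ε

/-- The restriction of a curve to `[s, t]`. -/
def Curve.sub (γ : Curve X) (s t : ℝ) (hs : 0 ≤ s) (hst : s < t) (ht : t ≤ γ.len) : Curve X where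
  len := t - s
  len_pos := sub_pos.mpr hst
  toFun r := γ.toFun (s + r)
  continuousOn := γ.continuousOn.comp (by fun_prop) fun r hr =>
    ⟨by linarith [hr.1], by linarith [hr.2]⟩
  arclength a b ha hb hab := by
    have h := eVariationOn.comp_eq_of_monotoneOn γ.toFun (t := Icc a b) (fun r => s + r)
      (fun x _ y _ hxy => by simpa using hxy)
    rw [image_const_add_Icc, γ.arclength (s + a) (s + b)
      ⟨by linarith [ha.1], by linarith [ha.2]⟩ ⟨by linarith [hb.1], by linarith [hb.2]⟩
      (by linarith), add_sub_add_left_eq_sub] at h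
    exact h
  nonconstant := by
    by_contra! hc
    have h := γ.arclength s t ⟨hs, hst.le.trans ht⟩ ⟨hs.trans hst.le, ht⟩ hst.le
    have h0 : eVariationOn γ.toFun (Icc s t) = 0 := by
      rw [eVariationOn.eq_zero_iff]
      intro x hx y hy
      have := hc (x - s) ⟨by linarith [hx.1], by linarith [hx.2]⟩
        (y - s) ⟨by linarith [hy.1], by linarith [hy.2]⟩
      rw [add_sub_cancel, add_sub_cancel] at this
      rw [this, edist_self]
    rw [h0, eq_comm, ENNReal.ofReal_eq_zero] at h
    linarith

theorem Curve.integral_sub (γ : Curve X) {s t : ℝ} (hs : 0 ≤ s) (hst : s < t) (ht : t ≤ γ.len)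
    (g : X → ℝ≥0∞) :
    (γ.sub s t hs hst ht).integral g = ∫⁻ r in Icc s t, g (γ.toFun r) := by
  have h := (measurePreserving_add_left (volume : Measure ℝ) s).setLIntegral_comp_preimage_emb
    (MeasurableEquiv.addLeft s).measurableEmbedding (fun r => g (γ.toFun r)) (Icc s t)
  rw [← h, preimage_const_add_Icc, sub_self]
  rfl

theorem Curve.aemeasurable_comp (γ : Curve X) {g : X → ℝ≥0∞} (hg : Measurable g) :
    AEMeasurable (fun r => g (γ.toFun r)) (volume.restrict (Icc 0 γ.len)) :=
  hg.comp_aemeasurable (γ.continuousOn.aemeasurable measurableSet_Icc)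

theorem ZeroModulus.mono {p : ℝ} {μ : Measure X} {Γ Γ' : Set (Curve X)}
    (h : ZeroModulus p μ Γ') (hsub : Γ ⊆ Γ') : ZeroModulus p μ Γ := by
  obtain ⟨ρ, hm, hi, hρ⟩ := h
  exact ⟨ρ, hm, hi, fun γ hγ => hρ γ (hsub hγ)⟩

theorem lintegral_add_rpow_lt_top {p : ℝ} (hp : 1 ≤ p) {μ : Measure X} {f g : X → ℝ≥0∞}
    (hf : AEMeasurable f μ) (hg : AEMeasurable g μ) (hf' : ∫⁻ x, f x ^ p ∂μ < ⊤)
    (hg' : ∫⁻ x, g x ^ p ∂μ < ⊤) : ∫⁻ x, (f x + g x) ^ p ∂μ < ⊤ := by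
  have hp0 : 0 < 1 / p := by positivity
  rw [← ENNReal.rpow_lt_top_iff_of_pos hp0]
  refine (ENNReal.lintegral_Lp_add_le hf hg hp).trans_lt (ENNReal.add_lt_top.mpr ⟨?_, ?_⟩)
  · rwa [ENNReal.rpow_lt_top_iff_of_pos hp0]
  · rwa [ENNReal.rpow_lt_top_iff_of_pos hp0]

theorem ZeroModulus.union {p : ℝ} (hp : 1 ≤ p) {μ : Measure X} {Γ Γ' : Set (Curve X)}
    (h : ZeroModulus p μ Γ) (h' : ZeroModulus p μ Γ') : ZeroModulus p μ (Γ ∪ Γ') := by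
  obtain ⟨ρ, hm, hi, hρ⟩ := h
  obtain ⟨ρ', hm', hi', hρ'⟩ := h'
  refine ⟨fun x => ρ x + ρ' x, hm.add hm',
    lintegral_add_rpow_lt_top hp hm.aemeasurable hm'.aemeasurable hi hi', fun γ hγ => ?_⟩
  rw [eq_top_iff]
  rcases hγ with hγ | hγ
  · rw [← hρ γ hγ]
    exact lintegral_mono fun r => le_self_add
  · rw [← hρ' γ hγ]
    exact lintegral_mono fun r => le_add_self

theorem zeroModulus_integral_eq_top {p : ℝ} {μ : Measure X} {g : X → ℝ≥0∞} (hg : Measurable g)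
    (hi : ∫⁻ x, g x ^ p ∂μ < ⊤) : ZeroModulus p μ {γ : Curve X | γ.integral g = ⊤} :=
  ⟨g, hg, hi, fun _ h => h⟩

/-- If a family has zero modulus, then so does the family of curves with a subcurve in it. -/
theorem ZeroModulus.superCurves {p : ℝ} {μ : Measure X} {Γ : Set (Curve X)}
    (h : ZeroModulus p μ Γ) :
    ZeroModulus p μ {γ : Curve X | ∃ s t hs hst ht, γ.sub s t hs hst ht ∈ Γ} := by
  obtain ⟨ρ, hm, hi, hρ⟩ := h
  refine ⟨ρ, hm, hi, ?_⟩
  rintro γ ⟨s, t, hs, hst, ht, hγ⟩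
  rw [eq_top_iff, ← hρ _ hγ, γ.integral_sub]
  exact lintegral_mono_set (Icc_subset_Icc hs ht)

theorem ugDiff_coe (a b : ℝ) : ugDiff (a : EReal) (b : EReal) = edist a b := by
  rw [ugDiff, if_neg (by simp [EReal.abs_def]), ← EReal.coe_sub, EReal.abs_def, edist_dist,
    Real.dist_eq]

/-- For almost every curve, a real-valued function satisfies the upper gradient inequality along
all subcurves and its weak upper gradient is integrable. -/
theorem IsWeakUpperGradient.zeroModulus_subcurves {p : ℝ} (hp : 1 ≤ p) {μ : Measure X}
    {f : X → ℝ} {g : X → ℝ≥0∞} (h : IsWeakUpperGradient p μ (fun x => (f x : EReal)) g)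
    (hi : ∫⁻ x, g x ^ p ∂μ < ⊤) :
    ZeroModulus p μ {γ : Curve X | ¬ (γ.integral g ≠ ⊤ ∧ ∀ s t, 0 ≤ s → s ≤ t → t ≤ γ.len →
      edist (f (γ.toFun s)) (f (γ.toFun t)) ≤ ∫⁻ r in Icc s t, g (γ.toFun r))} := by
  refine ((zeroModulus_integral_eq_top h.1 hi).union hp h.2.superCurves).mono fun γ hγ => ?_
  by_contra hc
  simp only [mem_union, mem_ofPred_eq, not_or] at hc
  refine hγ ⟨hc.1, fun s t hs hst ht => ?_⟩
  rcases hst.eq_or_lt with rfl | hlt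
  · simp
  · by_contra hbad
    refine hc.2 ⟨s, t, hs, hlt, ht, fun hug => hbad ?_⟩
    have h2 : ugDiff (f (γ.toFun (s + 0)) : EReal) (f (γ.toFun (s + (t - s))) : EReal) ≤ _ := hug
    rwa [γ.integral_sub, ugDiff_coe, add_zero, add_sub_cancel] at h2

/-- Leibniz rule for weak upper gradients of functions with values in `[0, 1]`. -/
theorem IsWeakUpperGradient.mul {p : ℝ} (hp : 1 ≤ p) {μ : Measure X} {w η : X → ℝ}
    {g k ω : X → ℝ≥0∞} (hw0 : ∀ x, 0 ≤ w x) (hη0 : ∀ x, 0 ≤ η x) (hη1 : ∀ x, η x ≤ 1)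
    (hw : IsWeakUpperGradient p μ (fun x => (w x : EReal)) k) (hk : ∫⁻ x, k x ^ p ∂μ < ⊤)
    (hη : IsWeakUpperGradient p μ (fun x => (η x : EReal)) g) (hg : ∫⁻ x, g x ^ p ∂μ < ⊤)
    (hω : Measurable ω) (hwω : ∀ x, ENNReal.ofReal (w x) ≤ ω x) :
    IsWeakUpperGradient p μ (fun x => ((w x * η x : ℝ) : EReal)) (fun x => k x + ω x * g x) := by
  refine ⟨hw.1.add (hω.mul hη.1), ((hw.zeroModulus_subcurves hp hk).union hp
    (hη.zeroModulus_subcurves hp hg)).mono fun γ hγ => ?_⟩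
  by_contra hc
  simp only [mem_union, mem_ofPred_eq, not_or, not_not] at hc
  refine hγ ?_
  rw [UGOn, ugDiff_coe]
  refine (edist_mul_le_setLIntegral (W := fun r => w (γ.toFun r)) (H := fun r => η (γ.toFun r))
    γ.len_pos (fun _ => hw0 _) (fun _ => hη0 _) (fun _ => hη1 _) hc.1.1 hc.2.1
    (γ.aemeasurable_comp hη.1) hc.1.2 hc.2.2).trans ?_
  refine lintegral_mono fun r => ?_
  exact add_le_add le_rfl (mul_le_mul' (hwω _) le_rfl)

theorem IsWeakUpperGradient.const_mul_add {p : ℝ} (hp : 1 ≤ p) {μ : Measure X} {u v : X → ℝ}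
    {g k : X → ℝ≥0∞} (c : ℝ≥0)
    (hu : IsWeakUpperGradient p μ (fun x => (u x : EReal)) g)
    (hv : IsWeakUpperGradient p μ (fun x => (v x : EReal)) k) :
    IsWeakUpperGradient p μ (fun x => ((c * u x + v x : ℝ) : EReal)) (fun x => c * g x + k x) := by
  refine ⟨(hu.1.const_mul _).add hv.1, (hu.2.union hp hv.2).mono fun γ hγ => ?_⟩
  by_contra hc
  simp only [mem_union, mem_ofPred_eq, not_or, not_not, UGOn, ugDiff_coe] at hc
  refine hγ ?_
  rw [UGOn, ugDiff_coe]
  calc _ ≤ c * edist (u (γ.toFun 0)) (u (γ.toFun γ.len))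
        + edist (v (γ.toFun 0)) (v (γ.toFun γ.len)) := by
        refine (edist_add_add_le _ _ _ _).trans (add_le_add_left (le_of_eq ?_) _)
        rw [edist_dist, edist_dist, Real.dist_eq, Real.dist_eq, ← mul_sub, abs_mul,
          NNReal.abs_eq, ENNReal.ofReal_mul c.coe_nonneg, ENNReal.ofReal_coe_nnreal]
    _ ≤ c * γ.integral g + γ.integral k := by gcongr <;> [exact hc.1; exact hc.2]
    _ ≤ _ := by
        unfold Curve.integral
        rw [← lintegral_const_mul' _ _ ENNReal.coe_ne_top]
        exact le_lintegral_add _ _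

/-! ### Truncation to `[0, 1]` -/

/-- Truncation of an extended real number to `[0, 1]`. -/
def unitTrunc (a : EReal) : ℝ := (min (max a 0) 1).toReal

theorem coe_unitTrunc (a : EReal) : (unitTrunc a : EReal) = min (max a 0) 1 := by
  refine EReal.coe_toReal ?_ ?_
  · exact ((min_le_right _ _).trans_lt (EReal.coe_lt_top 1)).ne
  · exact ((EReal.bot_lt_coe 0).trans_le (le_min (le_max_right _ _) zero_le_one)).ne'

theorem unitTrunc_coe (a : ℝ) : unitTrunc a = min (max a 0) 1 := by
  have h := coe_unitTrunc a
  rw [← EReal.coe_zero, ← EReal.coe_one, ← EReal.coe_strictMono.monotone.map_max,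
    ← EReal.coe_strictMono.monotone.map_min] at h
  exact_mod_cast h

theorem unitTrunc_nonneg (a : EReal) : 0 ≤ unitTrunc a := by
  rw [← EReal.coe_nonneg, coe_unitTrunc]
  exact le_min (le_max_right _ _) zero_le_one

theorem unitTrunc_le_one (a : EReal) : unitTrunc a ≤ 1 := by
  rw [← EReal.coe_le_coe_iff, coe_unitTrunc]
  exact min_le_right _ _

theorem unitTrunc_of_one_le {a : EReal} (h : 1 ≤ a) : unitTrunc a = 1 := by
  rw [unitTrunc, min_eq_right (h.trans (le_max_left _ _)), EReal.toReal_one]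

theorem unitTrunc_zero : unitTrunc 0 = 0 := by simp [unitTrunc]

theorem measurable_unitTrunc : Measurable unitTrunc :=
  measurable_ereal_toReal.comp ((measurable_id.max measurable_const).min measurable_const)

theorem ofReal_unitTrunc_le (a : EReal) : ENNReal.ofReal (unitTrunc a) ≤ a.abs := by
  induction a with
  | bot => simp [EReal.abs_bot]
  | top => simp [EReal.abs_top]
  | coe a =>
    rw [unitTrunc_coe, EReal.abs_def]
    exact ENNReal.ofReal_le_ofReal ((min_le_left _ _).trans (max_le (le_abs_self a) (abs_nonneg a)))

theorem edist_unitTrunc_le (a b : EReal) : edist (unitTrunc a) (unitTrunc b) ≤ ugDiff a b := by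
  by_cases h : a.abs = ⊤ ∨ b.abs = ⊤
  · rw [ugDiff, if_pos h]; exact le_top
  · push Not at h
    lift a to ℝ using
      ⟨by rintro rfl; simp [EReal.abs_top] at h, by rintro rfl; simp [EReal.abs_bot] at h⟩
    lift b to ℝ using
      ⟨by rintro rfl; simp [EReal.abs_top] at h, by rintro rfl; simp [EReal.abs_bot] at h⟩
    rw [ugDiff_coe, unitTrunc_coe, unitTrunc_coe]
    have h1 : LipschitzWith 1 fun x : ℝ => min (max x 0) 1 :=
      (LipschitzWith.id.max_const 0).min_const 1
    simpa using h1 a b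

theorem IsWeakUpperGradient.unitTrunc {p : ℝ} {μ : Measure X} {u : X → EReal} {g : X → ℝ≥0∞}
    (h : IsWeakUpperGradient p μ u g) :
    IsWeakUpperGradient p μ (fun x => (_root_.unitTrunc (u x) : EReal)) g := by
  refine ⟨h.1, h.2.mono fun γ hγ hug => hγ ?_⟩
  rw [UGOn, ugDiff_coe]
  exact (edist_unitTrunc_le _ _).trans hug

theorem exists_isWeakUpperGradient_of_gradEnergy_lt {p : ℝ} {μ : Measure X} {u : X → EReal}
    {c : ℝ≥0∞} (h : gradEnergy p μ u < c) :
    ∃ g, IsWeakUpperGradient p μ u g ∧ ∫⁻ x, g x ^ p ∂μ < c := by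
  simpa only [gradEnergy, iInf_lt_iff, exists_prop] using h

theorem gradEnergy_le {p : ℝ} {μ : Measure X} {u : X → EReal} {g : X → ℝ≥0∞}
    (h : IsWeakUpperGradient p μ u g) : gradEnergy p μ u ≤ ∫⁻ x, g x ^ p ∂μ :=
  iInf₂_le g h

theorem memNewtonian_unitTrunc {p : ℝ} (hp : 0 ≤ p) {μ : Measure X} {u : X → EReal}
    (h : MemNewtonian p μ u) : MemNewtonian p μ fun x => (unitTrunc (u x) : EReal) := by
  refine ⟨measurable_coe_real_ereal.comp_aemeasurable
    (measurable_unitTrunc.comp_aemeasurable h.1), lt_of_le_of_lt (add_le_add ?_ ?_) h.2⟩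
  · refine lintegral_mono fun x => ENNReal.rpow_le_rpow ?_ hp
    rw [EReal.abs_def, abs_of_nonneg (unitTrunc_nonneg _)]
    exact ofReal_unitTrunc_le _
  · exact le_iInf₂ fun g hg => gradEnergy_le hg.unitTrunc

/-! ### Capacities -/

theorem varCapacity_mono {p : ℝ} {μ : Measure X} {A B E : Set X} (h : A ⊆ B) :
    varCapacity p μ A E ≤ varCapacity p μ B E :=
  le_iInf₂ fun u hu => iInf₂_le u ⟨hu.1, fun x hx => hu.2 x (h hx)⟩

theorem varCapacity_le_varCapacityT {p : ℝ} {μ : Measure X} {A E : Set X} :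
    varCapacity p μ A E ≤ varCapacityT p μ A E :=
  le_iInf₂ fun _ hG => varCapacity_mono hG.1

/-- Truncated competitor for a finite variational capacity. -/
theorem exists_of_varCapacity_lt {p : ℝ} (hp : 0 ≤ p) {μ : Measure X} {A E : Set X} {c : ℝ≥0∞}
    (h : varCapacity p μ A E < c) :
    ∃ (u : X → ℝ) (g : X → ℝ≥0∞), MemNewtonian p μ (fun x => (u x : EReal)) ∧
      IsWeakUpperGradient p μ (fun x => (u x : EReal)) g ∧ ∫⁻ x, g x ^ p ∂μ < c ∧
      (∀ x, 0 ≤ u x) ∧ (∀ x, u x ≤ 1) ∧ (∀ x ∈ A, u x = 1) ∧ ∀ x ∉ E, u x = 0 := by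
  simp only [varCapacity, iInf_lt_iff, exists_prop] at h
  obtain ⟨u, ⟨⟨hN, h0⟩, h1⟩, hc⟩ := h
  obtain ⟨g, hg, hgc⟩ := exists_isWeakUpperGradient_of_gradEnergy_lt hc
  exact ⟨fun x => unitTrunc (u x), g, memNewtonian_unitTrunc hp hN, hg.unitTrunc, hgc,
    fun _ => unitTrunc_nonneg _, fun _ => unitTrunc_le_one _,
    fun x hx => unitTrunc_of_one_le (h1 x hx),
    fun x hx => (congrArg unitTrunc (h0 x hx)).trans unitTrunc_zero⟩

/-- Truncated competitor for a finite Sobolev capacity. -/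
theorem exists_of_sobolevCapacity_lt {p : ℝ} (hp : 0 ≤ p) {μ : Measure X} {A : Set X} {c : ℝ≥0∞}
    (h : sobolevCapacity p μ A < c) :
    ∃ (w : X → ℝ) (k : X → ℝ≥0∞), AEMeasurable w μ ∧
      ∫⁻ x, ENNReal.ofReal (w x) ^ p ∂μ < c ∧
      IsWeakUpperGradient p μ (fun x => (w x : EReal)) k ∧ ∫⁻ x, k x ^ p ∂μ < c ∧
      (∀ x, 0 ≤ w x) ∧ (∀ x, w x ≤ 1) ∧ ∀ x ∈ A, w x = 1 := by
  simp only [sobolevCapacity, iInf_lt_iff, exists_prop] at h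
  obtain ⟨w, ⟨hN, h1⟩, hc⟩ := h
  obtain ⟨k, hk, hkc⟩ :=
    exists_isWeakUpperGradient_of_gradEnergy_lt (lt_of_le_of_lt le_add_self hc)
  refine ⟨fun x => unitTrunc (w x), k, measurable_unitTrunc.comp_aemeasurable hN.1,
    lt_of_le_of_lt (lintegral_mono fun x => ?_) (lt_of_le_of_lt le_self_add hc), hk.unitTrunc,
    hkc, fun _ => unitTrunc_nonneg _, fun _ => unitTrunc_le_one _,
    fun x hx => unitTrunc_of_one_le (h1 x hx).ge⟩
  exact ENNReal.rpow_le_rpow (ofReal_unitTrunc_le _) hp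

/-- An a.e.-measurable function with values in `[0, 1]` has a measurable majorant with values in
`[0, 1]` to which it is a.e. equal. -/
theorem exists_measurable_majorant {α : Type*} [MeasurableSpace α] {ν : Measure α} {f : α → ℝ≥0∞}
    (hf : AEMeasurable f ν) (hf1 : ∀ x, f x ≤ 1) :
    ∃ F : α → ℝ≥0∞, Measurable F ∧ (∀ x, F x ≤ 1) ∧ (∀ x, f x ≤ F x) ∧ f =ᵐ[ν] F := by
  classical
  obtain ⟨N, hN, hNm, hN0⟩ := exists_measurable_superset_of_null (ae_iff.mp hf.ae_eq_mk)
  have hoff : ∀ x ∉ N, f x = hf.mk f x := fun x hx => by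
    by_contra hne
    exact hx (hN hne)
  refine ⟨N.piecewise (fun _ => 1) (hf.mk f), measurable_const.piecewise hNm hf.measurable_mk,
    fun x => ?_, fun x => ?_, ?_⟩
  · by_cases hx : x ∈ N
    · rw [piecewise_eq_of_mem _ _ _ hx]
    · rw [piecewise_eq_of_notMem _ _ _ hx, ← hoff x hx]
      exact hf1 x
  · by_cases hx : x ∈ N
    · rw [piecewise_eq_of_mem _ _ _ hx]
      exact hf1 x
    · rw [piecewise_eq_of_notMem _ _ _ hx, ← hoff x hx]
  · filter_upwards [measure_eq_zero_iff_ae_notMem.mp hN0] with x hx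
    rw [piecewise_eq_of_notMem _ _ _ hx, hoff x hx]

/-- If `~cap_p(A, E)` is finite, it is approximately bounded by the energy of any quasicontinuous
competitor for `cap_p(A, E)`. -/
theorem varCapacityT_rpow_le {p : ℝ} (hp : 1 ≤ p) {μ : Measure X}
    (hqc : ∀ u : X → EReal, MemNewtonian p μ u → QuasicontinuousFun p μ u)
    {A E : Set X} {K : ℝ≥0∞} (hK : K ≠ ⊤) (hA : varCapacity p μ A E < K)
    (hT : varCapacityT p μ A E < ⊤) {c : ℝ≥0} (hc : 1 < c) {ε : ℝ≥0} (hε : 0 < ε) :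
    varCapacityT p μ A E ^ (1 / p) ≤ c * K ^ (1 / p) + (ε + ε) := by
  have hp0 : 0 < p := by linarith
  have hip : 0 < 1 / p := by positivity
  have hc0 : (0 : ℝ) < c := lt_trans one_pos (by exact_mod_cast hc)
  simp only [varCapacityT, iInf_lt_iff, exists_prop] at hT
  obtain ⟨G₀, ⟨hAG₀, -, U₀, hU₀, rfl⟩, hG₀⟩ := hT
  obtain ⟨η, g, hηN, hη, hg, hη0, hη1, hηG, hηE⟩ := exists_of_varCapacity_lt hp0.le hG₀
  obtain ⟨u, gu, huN, hu, hgu, hu0, hu1, huA, huE⟩ := exists_of_varCapacity_lt hp0.le hA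
  have hεp : (ε : ℝ≥0∞) ^ p ≠ 0 := by
    simp [ENNReal.rpow_eq_zero_iff, hε.ne', hp0.not_gt]
  obtain ⟨δ, hδ, hδg⟩ := exists_forall_lintegral_mul_rpow_le hp0 hη.1 hg.ne hεp
  obtain ⟨G, hGo, hGcap, -, hcont⟩ := hqc _ huN (min δ ((ε : ℝ≥0∞) ^ p))
    (lt_min hδ (pos_iff_ne_zero.mpr hεp))
  obtain ⟨w, k, hwm, hwp, hw, hk, hw0, hw1, hwG⟩ := exists_of_sobolevCapacity_lt hp0.le hGcap
  obtain ⟨ω, hωm, hω1, hwω, hωae⟩ := exists_measurable_majorant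
    (hwm.ennreal_ofReal) (fun x => ENNReal.ofReal_le_one.mpr (hw1 x))
  have hωp : ∫⁻ x, ω x ^ p ∂μ < δ := by
    rw [← lintegral_congr_ae (hωae.mono fun x hx => by rw [← hx])]
    exact hwp.trans_le (min_le_left _ _)
  have hkε : ∫⁻ x, k x ^ p ∂μ ≤ (ε : ℝ≥0∞) ^ p := (hk.trans_le (min_le_right _ _)).le
  have hωg : ∫⁻ x, (ω x * g x) ^ p ∂μ ≤ (ε : ℝ≥0∞) ^ p := hδg ω hωm hω1 hωp
  obtain ⟨V, hVo, hV⟩ := continuousOn_iff'.mp hcont (Ioi ((c⁻¹ : ℝ) : EReal)) isOpen_Ioi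
  have hVmem : ∀ x ∉ G, x ∈ V ↔ (c : ℝ)⁻¹ < u x := fun x hx => by
    have := Set.ext_iff.mp hV x
    simp only [mem_inter_iff, mem_preimage, mem_Ioi, mem_compl_iff, hx, not_false_eq_true,
      and_true, EReal.coe_lt_coe_iff] at this
    exact this.symm
  have hmul := IsWeakUpperGradient.mul hp hw0 hη0 hη1 hw (hk.trans_le le_top) hη hg hωm hwω
  have hF := hu.const_mul_add hp c hmul
  have hkωm : Measurable fun x => k x + ω x * g x := hw.1.add (hωm.mul hη.1)
  have hbound : (∫⁻ x, (c * gu x + (k x + ω x * g x)) ^ p ∂μ) ^ (1 / p) ≤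
      c * K ^ (1 / p) + (ε + ε) := by
    refine (ENNReal.lintegral_Lp_add_le (hu.1.const_mul (c : ℝ≥0∞)).aemeasurable
      hkωm.aemeasurable hp).trans (add_le_add ?_ ((ENNReal.lintegral_Lp_add_le
        hw.1.aemeasurable (hωm.mul hη.1).aemeasurable hp).trans (add_le_add ?_ ?_)))
    · simp_rw [ENNReal.mul_rpow_of_nonneg _ _ hp0.le]
      rw [lintegral_const_mul' _ _ (ENNReal.rpow_lt_top_of_nonneg hp0.le ENNReal.coe_ne_top).ne,
        ENNReal.mul_rpow_of_nonneg _ _ hip.le, one_div, ENNReal.rpow_rpow_inv hp0.ne']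
      gcongr
    · rw [one_div, ENNReal.rpow_inv_le_iff hp0]
      exact hkε
    · rw [one_div, ENNReal.rpow_inv_le_iff hp0]
      exact hωg
  have hfin : ∫⁻ x, (c * gu x + (k x + ω x * g x)) ^ p ∂μ < ⊤ := by
    rw [← ENNReal.rpow_lt_top_iff_of_pos hip]
    refine hbound.trans_lt (ENNReal.add_lt_top.mpr ⟨ENNReal.mul_lt_top ENNReal.coe_lt_top
      (ENNReal.rpow_lt_top_of_nonneg hip.le hK), by simp⟩)
  have hum : AEMeasurable u μ := measurable_ereal_toReal.comp_aemeasurable huN.1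
  have hηm : AEMeasurable η μ := measurable_ereal_toReal.comp_aemeasurable hηN.1
  have hup : ∫⁻ x, (c * ENNReal.ofReal (u x)) ^ p ∂μ < ⊤ := by
    simp_rw [ENNReal.mul_rpow_of_nonneg _ _ hp0.le]
    have hcp := ENNReal.rpow_lt_top_of_nonneg hp0.le (ENNReal.coe_ne_top (r := c))
    rw [lintegral_const_mul' _ _ hcp.ne]
    refine ENNReal.mul_lt_top hcp (lt_of_le_of_lt ?_ (lt_of_le_of_lt le_self_add huN.2))
    simp [EReal.abs_def, abs_of_nonneg (hu0 _)]
  have hFN : MemNewtonian0 p μ E (fun x => ((c * u x + w x * η x : ℝ) : EReal)) := by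
    refine ⟨⟨measurable_coe_real_ereal.comp_aemeasurable
      ((hum.const_mul _).add (hwm.mul hηm)), ENNReal.add_lt_top.mpr
        ⟨?_, (gradEnergy_le hF).trans_lt hfin⟩⟩, fun x hx => by simp [huE x hx, hηE x hx]⟩
    refine lt_of_le_of_lt (lintegral_mono fun x => ENNReal.rpow_le_rpow ?_ hp0.le)
      (lintegral_add_rpow_lt_top hp (hum.ennreal_ofReal.const_mul (c : ℝ≥0∞))
        hwm.ennreal_ofReal hup (hwp.trans_le le_top))
    rw [EReal.abs_def, abs_of_nonneg (add_nonneg (mul_nonneg hc0.le (hu0 x))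
      (mul_nonneg (hw0 x) (hη0 x))), ENNReal.ofReal_add (mul_nonneg hc0.le (hu0 x))
      (mul_nonneg (hw0 x) (hη0 x)), ENNReal.ofReal_mul hc0.le, ENNReal.ofReal_coe_nnreal]
    gcongr
    exact mul_le_of_le_one_right (hw0 x) (hη1 x)
  have hle : varCapacityT p μ A E ≤ ∫⁻ x, (c * gu x + (k x + ω x * g x)) ^ p ∂μ := by
    refine (iInf₂_le ((U₀ ∩ (V ∪ G)) ∩ E) ⟨fun x hx => ⟨⟨(hAG₀ hx).1, ?_⟩, (hAG₀ hx).2⟩,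
      inter_subset_right, U₀ ∩ (V ∪ G), hU₀.inter (hVo.union hGo), rfl⟩).trans
      ((iInf₂_le _ ⟨hFN, fun x hx => ?_⟩).trans (gradEnergy_le hF))
    · by_cases hxG : x ∈ G
      · exact Or.inr hxG
      · refine Or.inl ((hVmem x hxG).mpr ?_)
        rw [huA x hx]
        exact inv_lt_one_of_one_lt₀ (by exact_mod_cast hc)
    · have hxη : η x = 1 := hηG x ⟨hx.1.1, hx.2⟩
      rw [← EReal.coe_one, EReal.coe_le_coe_iff, hxη]
      by_cases hxG : x ∈ G
      · rw [hwG x hxG]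
        linarith [mul_nonneg hc0.le (hu0 x)]
      · have := (hVmem x hxG).mp (hx.1.2.resolve_right hxG)
        rw [inv_lt_iff_one_lt_mul₀' hc0] at this
        linarith [hw0 x]
  exact (ENNReal.rpow_le_rpow hle hip.le).trans hbound

/-- For `p > 1`, if all Newtonian functions are quasicontinuous and `X`
has the zero `p`-weak upper gradient property, then for every `A ⊆ E` either
`~cap_p(A,E) = cap_p(A,E)` or `~cap_p(A,E) = ∞`. -/
theorem stmt_19 (p : ℝ) (hp : 1 < p) (μ : Measure X)
    (hball : ∀ (x : X) (r : ℝ), 0 < r → 0 < μ (Metric.ball x r) ∧ μ (Metric.ball x r) < ⊤)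
    (hqc : ∀ u : X → EReal, MemNewtonian p μ u → QuasicontinuousFun p μ u)
    (hz : ZeroWUGProperty p μ)
    (E : Set X) (hE : Bornology.IsBounded E)
    (A : Set X) (hAE : A ⊆ E) :
    varCapacityT p μ A E = varCapacity p μ A E ∨ varCapacityT p μ A E = ⊤ := by
  have hp0 : 0 < p := by linarith
  refine or_iff_not_imp_right.mpr fun hT => le_antisymm ?_ varCapacity_le_varCapacityT
  have hT' : varCapacityT p μ A E < ⊤ := lt_top_iff_ne_top.mpr hT
  refine le_of_forall_gt_imp_ge_of_dense fun K hAK => ?_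
  rcases eq_or_ne K ⊤ with rfl | hK
  · exact le_top
  rw [← ENNReal.rpow_le_rpow_iff (z := 1 / p) (by positivity)]
  have hKp : K ^ (1 / p) ≠ ⊤ := (ENNReal.rpow_lt_top_of_nonneg (by positivity) hK).ne
  have hc : ∀ c : ℝ≥0, 1 < c → varCapacityT p μ A E ^ (1 / p) ≤ c * K ^ (1 / p) := by
    intro c hc
    refine ENNReal.le_of_forall_pos_le_add fun ε hε _ => ?_
    have := varCapacityT_rpow_le hp.le hqc hK hAK hT' hc (half_pos hε)
    rwa [← ENNReal.coe_add, add_halves] at this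
  have hlim : Tendsto (fun c : ℝ≥0 => (c : ℝ≥0∞) * K ^ (1 / p)) (𝓝[>] 1)
      (𝓝 (((1 : ℝ≥0) : ℝ≥0∞) * K ^ (1 / p))) :=
    (ENNReal.Tendsto.mul_const (ENNReal.tendsto_coe.mpr tendsto_id)
      (Or.inr hKp)).mono_left nhdsWithin_le_nhds
  rw [ENNReal.coe_one, one_mul] at hlim
  exact ge_of_tendsto hlim (eventually_nhdsWithin_of_forall fun c hc' => hc c hc')

end
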